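/- For every s < ∞, the level set Φ_s = { φ ∈ C([0,1]; ℝ^d) : S²(φ) ≤ s } is a compact subset of C([0,1]; ℝ^d), where S²(φ) = inf{ (1/2)∫ ‖z‖² P(dz dy dt) : (φ, P) is a viable pair for Regime 2 with initial point x₀ } (with the infimum over the empty set equal to +∞). -/

import Mathlib

open MeasureTheory Matrix Filter

noncomputable section

/-- The control space `Z = ℝ^d`. -/
abbrev Ctrl (d : ℕ) := Fin d → ℝ

/-- The `d`-dimensional torus `𝕋^d = ℝ^d/ℤ^d`. -/
abbrev Torus (d : ℕ) := Fin d → AddCircle (1 : ℝ)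

/-- The time interval `[0,1]`. -/
abbrev I01 := Set.Icc (0 : ℝ) 1

/-- The space `ℝ^d × 𝕋^d × [0,1]` on which occupation measures live. -/
abbrev Spc (d : ℕ) := Ctrl d × Torus d × I01

/-- The canonical projection `ℝ^d → 𝕋^d`. -/
def torusProj (d : ℕ) (w : Fin d → ℝ) : Torus d := fun i => (w i : AddCircle (1 : ℝ))

/-- `λ₂(x,y,z) = γ b(x,y) + c(x,y) + σ(x,y) z`. -/
def lam2 {d : ℕ} (γ : ℝ) (b c : (Fin d → ℝ) → Torus d → Fin d → ℝ)
    (σ : (Fin d → ℝ) → Torus d → Matrix (Fin d) (Fin d) ℝ)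
    (x : Fin d → ℝ) (y : Torus d) (z : Ctrl d) : Fin d → ℝ :=
  fun i => γ * b x y i + c x y i + (σ x y).mulVec z i

/-- A function `F : ℝ^d → ℝ` is a `C²` representative of a test function on the torus
if it is twice continuously differentiable and `ℤ^d`-periodic. -/
def IsC2Periodic {d : ℕ} (F : (Fin d → ℝ) → ℝ) : Prop :=
  ContDiff ℝ 2 F ∧ ∀ (w : Fin d → ℝ) (m : Fin d → ℤ), F (w + fun i => (m i : ℝ)) = F w

/-- The generator `ℒ²_{z,x} f(y)`, expressed through a periodic representative
`F = f ∘ π` on `ℝ^d`: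
`ℒ²_{z,x}F(w) = λ₂(x, π w, z)·∇F(w) + (γ/2) Σ_{ij} (σσᵀ)_{ij}(x, π w) ∂²F(w)/∂w_i∂w_j`. -/
def gen2 {d : ℕ} (γ : ℝ) (b c : (Fin d → ℝ) → Torus d → Fin d → ℝ)
    (σ : (Fin d → ℝ) → Torus d → Matrix (Fin d) (Fin d) ℝ)
    (x : Fin d → ℝ) (z : Ctrl d) (F : (Fin d → ℝ) → ℝ) (w : Fin d → ℝ) : ℝ :=
  (∑ i, lam2 γ b c σ x (torusProj d w) z i * fderiv ℝ F w (Pi.single i 1)) +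
    (γ / 2) * ∑ i, ∑ j, (σ x (torusProj d w) * (σ x (torusProj d w))ᵀ) i j *
      fderiv ℝ (fun v => fderiv ℝ F v (Pi.single j 1)) w (Pi.single i 1)

/-- A pair `(ψ, P)`, with `ψ ∈ C([0,1]; ℝ^d)` and `P` a Borel probability measure on
`ℝ^d × 𝕋^d × [0,1]`, is *viable* (for Regime 2 with initial point `x₀`) if
`P` has finite second moment in `z`, `ψ_t = x₀ + ∫_{ℝ^d×𝕋^d×[0,t]} λ₂(ψ_s,y,z) dP`,
`∫_{ℝ^d×𝕋^d×[0,t]} ℒ²_{z,ψ_s} f(y) dP = 0` for every `f ∈ C²(𝕋^d)` and `t ∈ [0,1]`,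
and the last marginal of `P` is Lebesgue measure. -/
def IsViablePair {d : ℕ} (γ : ℝ) (x₀ : Fin d → ℝ)
    (b c : (Fin d → ℝ) → Torus d → Fin d → ℝ)
    (σ : (Fin d → ℝ) → Torus d → Matrix (Fin d) (Fin d) ℝ)
    (ψ : C(I01, Fin d → ℝ)) (P : Measure (Spc d)) : Prop :=
  IsProbabilityMeasure P ∧
  Integrable (fun p : Spc d => ∑ i, (p.1 i) ^ 2) P ∧
  (∀ t : I01, ψ t = fun i => x₀ i +
      ∫ p in {p : Spc d | (p.2.2 : ℝ) ≤ (t : ℝ)}, lam2 γ b c σ (ψ p.2.2) p.2.1 p.1 i ∂P) ∧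
  (∀ F : (Fin d → ℝ) → ℝ, IsC2Periodic F →
    ∀ g : Spc d → ℝ,
      (∀ (z : Ctrl d) (w : Fin d → ℝ) (s : I01), g (z, torusProj d w, s) = gen2 γ b c σ (ψ s) z F w) →
      ∀ t : I01, ∫ p in {p : Spc d | (p.2.2 : ℝ) ≤ (t : ℝ)}, g p ∂P = 0) ∧
  (∀ t : I01, P {p : Spc d | (p.2.2 : ℝ) ≤ (t : ℝ)} = ENNReal.ofReal t)

end

/-- The rate functional
`S²(φ) = inf { (1/2)∫‖z‖² dP : (φ,P) viable for Regime 2 with initial point x₀ }`,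
with the infimum over the empty set equal to `+∞`. -/
noncomputable def S2 {d : ℕ} (γ : ℝ) (x₀ : Fin d → ℝ)
    (b c : (Fin d → ℝ) → Torus d → Fin d → ℝ)
    (σ : (Fin d → ℝ) → Torus d → Matrix (Fin d) (Fin d) ℝ)
    (φ : C(I01, Fin d → ℝ)) : ENNReal :=
  ⨅ (P : Measure (Spc d)) (_ : IsViablePair γ x₀ b c σ φ P),
    ENNReal.ofReal ((1 / 2) * ∫ p, ∑ i, (p.1 i) ^ 2 ∂P)

/-- The probability measures on `ℝ^d × 𝕋^d × [0,1]` whose second moment in the control variable is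
at most `C` and whose time marginal is Lebesgue measure. -/
def occMeasures (d : ℕ) (C : ℝ) : Set (ProbabilityMeasure (Spc d)) :=
  {P | ∫⁻ p, ENNReal.ofReal (∑ i, (p.1 i) ^ 2) ∂(P : Measure (Spc d)) ≤ ENNReal.ofReal C ∧
    ∀ t : I01, (P : Measure (Spc d)) {p | (p.2.2 : ℝ) ≤ (t : ℝ)} = ENNReal.ofReal t}

lemma sq_norm_le_sum_sq {d : ℕ} (z : Fin d → ℝ) : ‖z‖ ^ 2 ≤ ∑ i, (z i) ^ 2 := by
  have h0 : 0 ≤ ∑ i, (z i) ^ 2 := Finset.sum_nonneg fun i _ => sq_nonneg _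
  have h : ‖z‖ ≤ Real.sqrt (∑ i, (z i) ^ 2) := by
    refine (pi_norm_le_iff_of_nonneg (Real.sqrt_nonneg _)).2 fun i => ?_
    rw [Real.norm_eq_abs]
    exact Real.abs_le_sqrt
      (Finset.single_le_sum (f := fun i => (z i) ^ 2) (fun i _ => sq_nonneg _) (Finset.mem_univ i))
  calc ‖z‖ ^ 2 ≤ Real.sqrt (∑ i, (z i) ^ 2) ^ 2 := by gcongr
    _ = _ := Real.sq_sqrt h0

lemma continuous_sum_sq_ctrl {d : ℕ} : Continuous fun p : Spc d => ∑ i, (p.1 i) ^ 2 := by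
  fun_prop

lemma measurableSet_time_le {d : ℕ} (t : ℝ) : MeasurableSet {p : Spc d | (p.2.2 : ℝ) ≤ t} :=
  (isClosed_le (by fun_prop) continuous_const).measurableSet

namespace occMeasures

variable {d : ℕ} {C : ℝ} {P : ProbabilityMeasure (Spc d)}

lemma integrable_sum_sq (hP : P ∈ occMeasures d C) :
    Integrable (fun p : Spc d => ∑ i, (p.1 i) ^ 2) (P : Measure (Spc d)) := by
  refine ⟨continuous_sum_sq_ctrl.aestronglyMeasurable, ?_⟩
  rw [hasFiniteIntegral_iff_ofReal (.of_forall fun p => Finset.sum_nonneg fun i _ => sq_nonneg _)]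
  exact hP.1.trans_lt ENNReal.ofReal_lt_top

lemma integral_sum_sq_le (hC : 0 ≤ C) (hP : P ∈ occMeasures d C) :
    ∫ p, ∑ i, (p.1 i) ^ 2 ∂(P : Measure (Spc d)) ≤ C := by
  have h := hP.1
  rwa [← ofReal_integral_eq_lintegral_ofReal (integrable_sum_sq hP)
    (.of_forall fun p => Finset.sum_nonneg fun i _ => sq_nonneg _),
    ENNReal.ofReal_le_ofReal_iff hC] at h

lemma one_add_norm_le {η : ℝ} (hη : 0 < η) (z : Fin d → ℝ) :
    1 + ‖z‖ ≤ (1 + 1 / (4 * η)) + η * ∑ i, (z i) ^ 2 := by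
  have h1 : ‖z‖ ≤ 1 / (4 * η) + η * ‖z‖ ^ 2 := by
    have : 1 / (4 * η) + η * ‖z‖ ^ 2 - ‖z‖ = (2 * η * ‖z‖ - 1) ^ 2 / (4 * η) := by
      field_simp
      ring
    have h2 : 0 ≤ (2 * η * ‖z‖ - 1) ^ 2 / (4 * η) := by positivity
    linarith
  have h3 := mul_le_mul_of_nonneg_left (sq_norm_le_sum_sq z) hη.le
  linarith

lemma integrable_one_add_norm (hP : P ∈ occMeasures d C) :
    Integrable (fun p : Spc d => 1 + ‖p.1‖) (P : Measure (Spc d)) := by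
  refine ((integrable_const (1 + 1 / (4 * (1 : ℝ)))).add
    ((integrable_sum_sq hP).const_mul 1)).mono'
    (by fun_prop : Continuous fun p : Spc d => 1 + ‖p.1‖).aestronglyMeasurable
    (.of_forall fun p => ?_)
  rw [Real.norm_of_nonneg (by positivity)]
  exact one_add_norm_le one_pos p.1

lemma setIntegral_one_add_norm_le (hC : 0 ≤ C) (hP : P ∈ occMeasures d C) {η : ℝ} (hη : 0 < η)
    (A : Set (Spc d)) :
    ∫ p in A, (1 + ‖p.1‖) ∂(P : Measure (Spc d)) ≤
      (1 + 1 / (4 * η)) * (P : Measure (Spc d)).real A + η * C := by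
  have hi := integrable_sum_sq hP
  calc ∫ p in A, (1 + ‖p.1‖) ∂(P : Measure (Spc d))
      ≤ ∫ p in A, ((1 + 1 / (4 * η)) + η * ∑ i, (p.1 i) ^ 2) ∂(P : Measure (Spc d)) :=
        integral_mono (integrable_one_add_norm hP).integrableOn
          ((integrable_const _).add (hi.integrableOn.const_mul η)) fun p => one_add_norm_le hη p.1
    _ = (1 + 1 / (4 * η)) * (P : Measure (Spc d)).real A +
          η * ∫ p in A, ∑ i, (p.1 i) ^ 2 ∂(P : Measure (Spc d)) := by
        rw [integral_add (integrable_const _) (hi.integrableOn.const_mul η), integral_const_mul,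
          setIntegral_const, smul_eq_mul, mul_comm]
    _ ≤ _ := by
        gcongr
        exact (setIntegral_le_integral hi
          (.of_forall fun p => Finset.sum_nonneg fun i _ => sq_nonneg _)).trans
          (integral_sum_sq_le hC hP)

lemma integrable_of_linear_growth (hP : P ∈ occMeasures d C) {f : Spc d → ℝ} (hf : Continuous f)
    {M : ℝ} (hM : ∀ p, |f p| ≤ M * (1 + ‖p.1‖)) : Integrable f (P : Measure (Spc d)) :=
  ((integrable_one_add_norm hP).const_mul M).mono' hf.aestronglyMeasurable (.of_forall hM)

lemma abs_setIntegral_le (hC : 0 ≤ C) (hP : P ∈ occMeasures d C) {f : Spc d → ℝ}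
    {M : ℝ} (hM0 : 0 ≤ M) (hM : ∀ p, |f p| ≤ M * (1 + ‖p.1‖)) {η : ℝ} (hη : 0 < η)
    (A : Set (Spc d)) :
    |∫ p in A, f p ∂(P : Measure (Spc d))| ≤
      M * ((1 + 1 / (4 * η)) * (P : Measure (Spc d)).real A + η * C) := by
  calc |∫ p in A, f p ∂(P : Measure (Spc d))|
      ≤ ∫ p in A, M * (1 + ‖p.1‖) ∂(P : Measure (Spc d)) := by
        rw [← Real.norm_eq_abs]
        exact norm_integral_le_of_norm_le ((integrable_one_add_norm hP).const_mul M).integrableOn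
          (.of_forall hM)
    _ ≤ _ := by
        rw [integral_const_mul]
        exact mul_le_mul_of_nonneg_left (setIntegral_one_add_norm_le hC hP hη A) hM0

lemma measureReal_time_le (hP : P ∈ occMeasures d C) (t : I01) :
    (P : Measure (Spc d)).real {p | (p.2.2 : ℝ) ≤ (t : ℝ)} = t := by
  rw [measureReal_def, hP.2 t, ENNReal.toReal_ofReal t.2.1]

lemma measureReal_time_Ioc_le (hP : P ∈ occMeasures d C) (t : I01) {u : ℝ} (htu : (t : ℝ) ≤ u) :
    (P : Measure (Spc d)).real {p | (t : ℝ) < (p.2.2 : ℝ) ∧ (p.2.2 : ℝ) ≤ u} ≤ u - t := by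
  obtain ⟨v, hv, hvu, htv⟩ : ∃ v : I01, (∀ w : I01, (w : ℝ) ≤ u → w ≤ v) ∧ (v : ℝ) ≤ u ∧ t ≤ v := by
    rcases le_total u 1 with h | h
    · exact ⟨⟨u, t.2.1.trans htu, h⟩, fun w hw => hw, le_rfl, htu⟩
    · exact ⟨1, fun w _ => w.2.2, h, t.2.2⟩
  have hsub : {p : Spc d | (t : ℝ) < (p.2.2 : ℝ) ∧ (p.2.2 : ℝ) ≤ u} ⊆
      {p | (p.2.2 : ℝ) ≤ (v : ℝ)} \ {p | (p.2.2 : ℝ) ≤ (t : ℝ)} :=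
    fun p hp => ⟨hv _ hp.2, not_le.2 hp.1⟩
  calc _ ≤ _ := measureReal_mono hsub
    _ = (v : ℝ) - t := by
      have hsub' : {p : Spc d | (p.2.2 : ℝ) ≤ (t : ℝ)} ⊆ {p | (p.2.2 : ℝ) ≤ (v : ℝ)} :=
        fun p hp => le_trans hp htv
      rw [measureReal_sdiff hsub' (measurableSet_time_le _), measureReal_time_le hP,
        measureReal_time_le hP]
    _ ≤ u - t := by linarith

lemma measureReal_norm_gt_le (hC : 0 ≤ C) (hP : P ∈ occMeasures d C) {R : ℝ} (hR : 0 < R) :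
    (P : Measure (Spc d)).real {p | R < ‖p.1‖} ≤ C / R ^ 2 := by
  have hR2 : 0 < R ^ 2 := by positivity
  rw [le_div_iff₀ hR2, mul_comm]
  calc R ^ 2 * (P : Measure (Spc d)).real {p | R < ‖p.1‖}
      ≤ R ^ 2 * (P : Measure (Spc d)).real {p | R ^ 2 ≤ ∑ i, (p.1 i) ^ 2} := by
        refine mul_le_mul_of_nonneg_left ?_ hR2.le
        have hsub : {p : Spc d | R < ‖p.1‖} ⊆ {p | R ^ 2 ≤ ∑ i, (p.1 i) ^ 2} := fun p hp =>
          (pow_le_pow_left₀ hR.le (le_of_lt hp) 2).trans (sq_norm_le_sum_sq p.1)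
        exact measureReal_mono hsub (measure_ne_top (P : Measure (Spc d)) _)
    _ ≤ ∫ p, ∑ i, (p.1 i) ^ 2 ∂(P : Measure (Spc d)) :=
        mul_meas_ge_le_integral_of_nonneg
          (.of_forall fun p => Finset.sum_nonneg fun i _ => sq_nonneg _) (integrable_sum_sq hP) _
    _ ≤ C := integral_sum_sq_le hC hP

end occMeasures

lemma isClosed_occMeasures (d : ℕ) (C : ℝ) : IsClosed (occMeasures d C) := by
  have hset : occMeasures d C = (⋂ n : ℕ, {P : ProbabilityMeasure (Spc d) | ∫⁻ p,
      ENNReal.ofReal (min (∑ i, (p.1 i) ^ 2) n) ∂(P : Measure (Spc d)) ≤ ENNReal.ofReal C}) ∩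
      {P | ∀ t : I01, (P : Measure (Spc d)) {p | (p.2.2 : ℝ) ≤ (t : ℝ)} = ENNReal.ofReal t} := by
    ext P
    refine and_congr_left fun _ => ?_
    rw [Set.mem_iInter]
    constructor
    · intro h n
      refine le_trans (lintegral_mono fun p => ?_) h
      exact ENNReal.ofReal_le_ofReal (min_le_left _ _)
    · intro h
      have hsup : ∀ p : Spc d, ENNReal.ofReal (∑ i, (p.1 i) ^ 2) =
          ⨆ n : ℕ, ENNReal.ofReal (min (∑ i, (p.1 i) ^ 2) n) := by
        intro p
        refine le_antisymm ?_ (iSup_le fun n => ENNReal.ofReal_le_ofReal (min_le_left _ _))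
        obtain ⟨n, hn⟩ := exists_nat_ge (∑ i, (p.1 i) ^ 2)
        exact le_iSup_of_le n (by rw [min_eq_left hn])
      simp_rw [hsup]
      rw [lintegral_iSup]
      · exact iSup_le h
      · intro n
        exact (continuous_sum_sq_ctrl.min continuous_const).measurable.ennreal_ofReal
      · intro m n hmn p
        exact ENNReal.ofReal_le_ofReal (min_le_min_left _ (by exact_mod_cast hmn))
  rw [hset]
  refine (isClosed_iInter fun n => ?_).inter ?_
  · refine isClosed_le ?_ continuous_const
    let f : BoundedContinuousFunction (Spc d) NNReal :=
      BoundedContinuousFunction.mkOfBound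
        ⟨fun p => (min (∑ i, (p.1 i) ^ 2) (n : ℝ)).toNNReal, by fun_prop⟩ n (by
          intro p q
          have h : ∀ p : Spc d, 0 ≤ min (∑ i, (p.1 i) ^ 2) (n : ℝ) := fun p =>
            le_min (Finset.sum_nonneg fun i _ => sq_nonneg _) (Nat.cast_nonneg n)
          simp only [ContinuousMap.coe_mk, NNReal.dist_eq, Real.coe_toNNReal _ (h _)]
          rw [abs_le]
          constructor <;> linarith [h p, h q, min_le_right (∑ i, (p.1 i) ^ 2) (n : ℝ),
            min_le_right (∑ i, (q.1 i) ^ 2) (n : ℝ)])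
    exact ProbabilityMeasure.continuous_lintegral_boundedContinuousFunction f
  · have hc : Continuous fun p : Spc d => p.2.2 := by fun_prop
    obtain ⟨ν, hν⟩ : ∃ ν : ProbabilityMeasure I01, (ν : Measure I01) = volume :=
      ⟨⟨volume, inferInstance⟩, rfl⟩
    have hmarg : {P : ProbabilityMeasure (Spc d) | ∀ t : I01,
        (P : Measure (Spc d)) {p | (p.2.2 : ℝ) ≤ (t : ℝ)} = ENNReal.ofReal t} =
        (fun P : ProbabilityMeasure (Spc d) => P.map hc.measurable.aemeasurable) ⁻¹'
          {ν} := by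
      ext P
      have happ : ∀ t : I01, ((P : Measure (Spc d)).map fun p => p.2.2) (Set.Iic t) =
          (P : Measure (Spc d)) {p | (p.2.2 : ℝ) ≤ (t : ℝ)} := fun t =>
        Measure.map_apply hc.measurable measurableSet_Iic
      rw [Set.mem_preimage, Set.mem_singleton_iff, ← ProbabilityMeasure.toMeasure_injective.eq_iff, hν,
        ProbabilityMeasure.toMeasure_map, Set.mem_ofPred_eq]
      constructor
      · intro h
        refine Measure.ext_of_Iic _ _ fun t => ?_
        rw [happ, h, unitInterval.volume_Iic]
      · intro h t
        rw [← happ, h, unitInterval.volume_Iic]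
    rw [hmarg]
    exact isClosed_singleton.preimage (ProbabilityMeasure.continuous_map hc)

lemma isCompact_occMeasures (d : ℕ) {C : ℝ} (hC : 0 ≤ C) : IsCompact (occMeasures d C) := by
  rw [← (isClosed_occMeasures d C).closure_eq]
  apply isCompact_closure_of_isTightMeasureSet
  rw [isTightMeasureSet_iff_exists_isCompact_measure_compl_le]
  intro ε hε
  obtain ⟨R, hR0, hR⟩ : ∃ R : ℝ, 0 < R ∧ ENNReal.ofReal (C / R ^ 2) ≤ ε := by
    have h1 : Tendsto (fun R : ℝ => ENNReal.ofReal (C / R ^ 2)) atTop (nhds 0) := by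
      rw [← ENNReal.ofReal_zero]
      exact ENNReal.tendsto_ofReal
        (tendsto_const_nhds.div_atTop (tendsto_pow_atTop two_ne_zero))
    obtain ⟨R, h2, h3⟩ := ((eventually_gt_atTop 0).and (h1.eventually (ge_mem_nhds hε))).exists
    exact ⟨R, h2, h3⟩
  refine ⟨Metric.closedBall 0 R ×ˢ Set.univ, (isCompact_closedBall 0 R).prod isCompact_univ, ?_⟩
  rintro _ ⟨P, hP, rfl⟩
  refine le_trans ?_ hR
  rw [← ENNReal.ofReal_toReal (measure_ne_top (P : Measure (Spc d)) _)]
  refine ENNReal.ofReal_le_ofReal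
    (le_trans (measureReal_mono ?_) (occMeasures.measureReal_norm_gt_le hC hP hR0))
  intro p hp
  simpa using hp

lemma continuous_integral_of_support_subset_compact {X Y : Type*} [TopologicalSpace X]
    [TopologicalSpace Y] [MeasurableSpace Y] [OpensMeasurableSpace Y] {G : X → Y → ℝ}
    (hG : Continuous (Function.uncurry G)) {K : Set Y} (hK : IsCompact K)
    (hGK : ∀ x, ∀ y ∉ K, G x y = 0) :
    Continuous fun q : X × ProbabilityMeasure Y => ∫ y, G q.1 y ∂(q.2 : Measure Y) := by
  have hGx : ∀ x, Continuous (G x) := fun x => hG.comp (Continuous.prodMk_right x)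
  have hbdd : ∀ x, ∃ M, 0 ≤ M ∧ ∀ y, ‖G x y‖ ≤ M := by
    intro x
    obtain ⟨M, hM⟩ := hK.exists_bound_of_continuousOn (hGx x).continuousOn
    refine ⟨max M 0, le_max_right _ _, fun y => ?_⟩
    by_cases hy : y ∈ K
    · exact (hM y hy).trans (le_max_left _ _)
    · rw [hGK x y hy, norm_zero]
      exact le_max_right _ _
  choose M hM0 hM using hbdd
  have hint : ∀ x (P : ProbabilityMeasure Y), Integrable (G x) (P : Measure Y) := fun x P =>
    (integrable_const (M x)).mono' (hGx x).aestronglyMeasurable (.of_forall (hM x))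
  rw [continuous_iff_continuousAt]
  rintro ⟨x₀, P₀⟩
  have h1 : Tendsto (fun q : X × ProbabilityMeasure Y => ∫ y, G x₀ y ∂(q.2 : Measure Y))
      (nhds (x₀, P₀)) (nhds (∫ y, G x₀ y ∂(P₀ : Measure Y))) :=
    ((ProbabilityMeasure.continuous_integral_boundedContinuousFunction
      (BoundedContinuousFunction.ofNormedAddCommGroup (G x₀) (hGx x₀) (M x₀) (hM x₀))).comp
        continuous_snd).tendsto (x₀, P₀)
  have h2 : Tendsto (fun q : X × ProbabilityMeasure Y =>
      ∫ y, (G q.1 y - G x₀ y) ∂(q.2 : Measure Y)) (nhds (x₀, P₀)) (nhds 0) := by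
    rw [Metric.tendsto_nhds]
    intro ε hε
    have hunif : ∀ᶠ x in nhds x₀, ∀ y ∈ K, ‖G x y - G x₀ y‖ < ε / 2 := by
      refine hK.eventually_forall_of_forall_eventually fun y _ => ?_
      have hc : Continuous fun z : X × Y => ‖G z.1 z.2 - G x₀ z.2‖ :=
        (hG.sub ((hGx x₀).comp continuous_snd)).norm
      exact hc.continuousAt.eventually_lt_const (by simpa using half_pos hε)
    filter_upwards [continuous_fst.continuousAt.eventually hunif] with q hq
    rw [dist_zero_right]
    have hle : ∀ y, ‖G q.1 y - G x₀ y‖ ≤ ε / 2 := by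
      intro y
      by_cases hy : y ∈ K
      · exact (hq y hy).le
      · rw [hGK _ y hy, hGK _ y hy, sub_zero, norm_zero]
        exact (half_pos hε).le
    have := norm_integral_le_of_norm_le_const (μ := (q.2 : Measure Y)) (.of_forall hle)
    rw [probReal_univ, mul_one] at this
    linarith
  have h3 := h2.add h1
  rw [zero_add] at h3
  refine h3.congr fun q => ?_
  rw [integral_sub (hint _ _) (hint _ _), sub_add_cancel]

/-- A continuous ramp equal to `1` on `(-∞, 0]` and to `0` on `[1, ∞)`. -/
noncomputable def ramp (u : ℝ) : ℝ := max 0 (min 1 (1 - u))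

lemma continuous_ramp : Continuous ramp := by unfold ramp; fun_prop

lemma ramp_nonneg (u : ℝ) : 0 ≤ ramp u := le_max_left _ _

lemma ramp_le_one (u : ℝ) : ramp u ≤ 1 := max_le zero_le_one (min_le_left _ _)

lemma ramp_of_nonpos {u : ℝ} (hu : u ≤ 0) : ramp u = 1 := by
  rw [ramp, min_eq_left (by linarith), max_eq_right zero_le_one]

lemma ramp_of_one_le {u : ℝ} (hu : 1 ≤ u) : ramp u = 0 := by
  rw [ramp, min_eq_right (by linarith), max_eq_left (by linarith)]

/-- A compactly supported continuous approximation, of parameter `r`, of the indicator function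
of `{(z, y, s) | s ≤ t}`. -/
noncomputable def cutoff {d : ℕ} (t r : ℝ) (p : Spc d) : ℝ :=
  ramp (((p.2.2 : ℝ) - t) / r ^ 2) * ramp (r * ‖p.1‖ - 1)

lemma continuous_cutoff {d : ℕ} (t r : ℝ) : Continuous (cutoff (d := d) t r) :=
  (continuous_ramp.comp (by fun_prop)).mul (continuous_ramp.comp (by fun_prop))

lemma cutoff_nonneg {d : ℕ} (t r : ℝ) (p : Spc d) : 0 ≤ cutoff t r p :=
  mul_nonneg (ramp_nonneg _) (ramp_nonneg _)

lemma cutoff_le_one {d : ℕ} (t r : ℝ) (p : Spc d) : cutoff t r p ≤ 1 :=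
  mul_le_one₀ (ramp_le_one _) (ramp_nonneg _) (ramp_le_one _)

lemma abs_indicator_sub_cutoff_le {d : ℕ} (t : ℝ) {r : ℝ} (hr : 0 < r) (p : Spc d) :
    |{p : Spc d | (p.2.2 : ℝ) ≤ t}.indicator 1 p - cutoff t r p| ≤
      ({p : Spc d | t < (p.2.2 : ℝ) ∧ (p.2.2 : ℝ) ≤ t + r ^ 2} ∪
        {p | 1 / r < ‖p.1‖}).indicator 1 p := by
  have h0 := cutoff_nonneg t r p
  have h1 := cutoff_le_one t r p
  have hr2 : 0 < r ^ 2 := by positivity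
  by_cases hp : p ∈ {p : Spc d | t < (p.2.2 : ℝ) ∧ (p.2.2 : ℝ) ≤ t + r ^ 2} ∪ {p | 1 / r < ‖p.1‖}
  · rw [Set.indicator_of_mem hp, Pi.one_apply]
    by_cases hp' : p ∈ {p : Spc d | (p.2.2 : ℝ) ≤ t}
    · rw [Set.indicator_of_mem hp', Pi.one_apply, abs_le]
      constructor <;> linarith
    · rw [Set.indicator_of_notMem hp', abs_le]
      constructor <;> linarith
  · rw [Set.indicator_of_notMem hp]
    simp only [Set.mem_union, Set.mem_ofPred_eq, not_or, not_and, not_le, not_lt] at hp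
    have hz : ramp (r * ‖p.1‖ - 1) = 1 := by
      refine ramp_of_nonpos ?_
      have := (le_div_iff₀' hr).1 hp.2
      linarith
    have hc : cutoff t r p = ramp (((p.2.2 : ℝ) - t) / r ^ 2) := by rw [cutoff, hz, mul_one]
    rcases le_or_gt (p.2.2 : ℝ) t with h | h
    · rw [Set.indicator_of_mem (show p ∈ {p : Spc d | (p.2.2 : ℝ) ≤ t} from h), hc,
        ramp_of_nonpos (div_nonpos_of_nonpos_of_nonneg (by linarith) hr2.le)]
      simp
    · rw [Set.indicator_of_notMem (show p ∉ {p : Spc d | (p.2.2 : ℝ) ≤ t} from not_le.2 h), hc,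
        ramp_of_one_le ((one_le_div hr2).2 (by linarith [hp.1 h]))]
      simp

lemma occMeasures.abs_setIntegral_sub_integral_cutoff_le {d : ℕ} {C : ℝ}
    {P : ProbabilityMeasure (Spc d)} (hC : 0 ≤ C) (hP : P ∈ occMeasures d C) {f : Spc d → ℝ}
    (hf : Continuous f) {M : ℝ} (hM0 : 0 ≤ M) (hM : ∀ p, |f p| ≤ M * (1 + ‖p.1‖)) (t : I01)
    {r : ℝ} (hr : 0 < r) (hr1 : r ≤ 1) :
    |∫ p in {p : Spc d | (p.2.2 : ℝ) ≤ (t : ℝ)}, f p ∂(P : Measure (Spc d)) -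
      ∫ p, cutoff t r p * f p ∂(P : Measure (Spc d))| ≤ 3 * M * (1 + C) * r := by
  set A : Set (Spc d) := {p | (t : ℝ) < (p.2.2 : ℝ) ∧ (p.2.2 : ℝ) ≤ t + r ^ 2}
  set B : Set (Spc d) := {p | 1 / r < ‖p.1‖}
  have hA_eq : A = {p : Spc d | (t : ℝ) < (p.2.2 : ℝ)} ∩ {p | (p.2.2 : ℝ) ≤ t + r ^ 2} := rfl
  have hAm : MeasurableSet A := by
    rw [hA_eq]
    exact (isOpen_lt continuous_const (by fun_prop)).measurableSet.inter (measurableSet_time_le _)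
  have hBm : MeasurableSet B := (isOpen_lt continuous_const (by fun_prop)).measurableSet
  have hfi := integrable_of_linear_growth hP hf hM
  have hcf : ∀ p, |cutoff t r p * f p| ≤ M * (1 + ‖p.1‖) := fun p => by
    rw [abs_mul, abs_of_nonneg (cutoff_nonneg _ _ _)]
    exact (mul_le_of_le_one_left (abs_nonneg _) (cutoff_le_one _ _ _)).trans (hM p)
  have hcfi : Integrable (fun p => cutoff t r p * f p) (P : Measure (Spc d)) :=
    integrable_of_linear_growth hP ((continuous_cutoff (t : ℝ) r).mul hf) hcf
  have hAB : (P : Measure (Spc d)).real (A ∪ B) ≤ (1 + C) * r ^ 2 := by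
    have hA := measureReal_time_Ioc_le hP t (u := t + r ^ 2) (by nlinarith)
    have hB := measureReal_norm_gt_le hC hP (one_div_pos.2 hr)
    have hCr : C / (1 / r) ^ 2 = C * r ^ 2 := by field_simp
    rw [hCr] at hB
    refine (measureReal_union_le _ _).trans ((add_le_add hA hB).trans (le_of_eq ?_))
    ring
  rw [← integral_indicator (measurableSet_time_le _),
    ← integral_sub (hfi.indicator (measurableSet_time_le _)) hcfi, ← Real.norm_eq_abs]
  calc _ ≤ ∫ p, (A ∪ B).indicator (fun p => M * (1 + ‖p.1‖)) p ∂(P : Measure (Spc d)) := by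
        refine norm_integral_le_of_norm_le
          (((integrable_one_add_norm hP).const_mul M).indicator (hAm.union hBm))
          (.of_forall fun p => ?_)
        have h := mul_le_mul (abs_indicator_sub_cutoff_le t hr p) (hM p) (abs_nonneg _)
          (Set.indicator_nonneg (fun _ _ => zero_le_one) _)
        rw [← abs_mul, sub_mul] at h
        rw [Real.norm_eq_abs]
        simpa only [Set.indicator_apply, Pi.one_apply, ite_mul, one_mul, zero_mul] using h
    _ = M * ∫ p in A ∪ B, (1 + ‖p.1‖) ∂(P : Measure (Spc d)) := by
        rw [integral_indicator (hAm.union hBm), integral_const_mul]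
    _ ≤ M * ((1 + 1 / (4 * r)) * ((1 + C) * r ^ 2) + r * C) := by
        refine mul_le_mul_of_nonneg_left ((setIntegral_one_add_norm_le hC hP hr _).trans ?_) hM0
        gcongr
    _ ≤ M * (3 * (1 + C) * r) := by
        refine mul_le_mul_of_nonneg_left ?_ hM0
        have : (1 + 1 / (4 * r)) * ((1 + C) * r ^ 2) = (1 + C) * r * (r + 1 / 4) := by
          field_simp
        rw [this]
        have h1 : 0 ≤ (1 + C) * r := by positivity
        nlinarith
    _ = _ := by ring

lemma continuousOn_setIntegral_occMeasures {X : Type*} [TopologicalSpace X] {d : ℕ} {C : ℝ}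
    (hC : 0 ≤ C) {H : X → Spc d → ℝ} (hH : Continuous (Function.uncurry H)) {M : ℝ} (hM0 : 0 ≤ M)
    (hM : ∀ x p, |H x p| ≤ M * (1 + ‖p.1‖)) (t : I01) :
    ContinuousOn (fun q : X × ProbabilityMeasure (Spc d) =>
      ∫ p in {p : Spc d | (p.2.2 : ℝ) ≤ (t : ℝ)}, H q.1 p ∂(q.2 : Measure (Spc d)))
      (Set.univ ×ˢ occMeasures d C) := by
  refine continuousOn_of_uniform_approx_of_continuousOn fun u hu => ?_
  obtain ⟨ε, hε, hεu⟩ := Metric.mem_uniformity_dist.1 hu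
  obtain ⟨r, hr, hr1, hrε⟩ : ∃ r : ℝ, 0 < r ∧ r ≤ 1 ∧ 3 * M * (1 + C) * r < ε := by
    have h1 : Tendsto (fun r : ℝ => 3 * M * (1 + C) * r) (nhdsWithin 0 (Set.Ioi 0)) (nhds 0) := by
      have : Continuous fun r : ℝ => 3 * M * (1 + C) * r := by fun_prop
      simpa using (this.tendsto 0).mono_left nhdsWithin_le_nhds
    obtain ⟨r, h2, h3⟩ := ((h1.eventually_lt_const hε).and
      (Ioc_mem_nhdsGT (zero_lt_one (α := ℝ)))).exists
    exact ⟨r, h3.1, h3.2, h2⟩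
  refine ⟨fun q => ∫ p, cutoff t r p * H q.1 p ∂(q.2 : Measure (Spc d)), ?_, ?_⟩
  · refine (continuous_integral_of_support_subset_compact (G := fun x p => cutoff t r p * H x p)
      (((continuous_cutoff _ _).comp continuous_snd).mul hH)
      ((isCompact_closedBall 0 (2 / r)).prod isCompact_univ) fun x p hp => ?_).continuousOn
    have hz : 2 / r < ‖p.1‖ := by simpa using hp
    have hz' : 2 < r * ‖p.1‖ := (div_lt_iff₀' hr).1 hz
    simp only [cutoff, ramp_of_one_le (show 1 ≤ r * ‖p.1‖ - 1 by linarith), mul_zero, zero_mul]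
  · rintro ⟨x, P⟩ ⟨-, hP⟩
    refine hεu ?_
    rw [Real.dist_eq]
    exact (occMeasures.abs_setIntegral_sub_integral_cutoff_le hC hP
      (hH.comp (Continuous.prodMk_right x)) hM0 (hM x) t hr hr1).trans_lt hrε

lemma isCompact_setOf_holder_half {d : ℕ} (x₀ : Fin d → ℝ) (L : ℝ) :
    IsCompact {φ : C(I01, Fin d → ℝ) | (∀ t i, |φ t i - x₀ i| ≤ L) ∧
      ∀ t u i, |φ t i - φ u i| ≤ L * Real.sqrt (dist t u)} := by
  refine ArzelaAscoli.isCompact_of_equicontinuous _ ?_ ?_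
  · have himage : ContinuousMap.toFun '' {φ : C(I01, Fin d → ℝ) | (∀ t i, |φ t i - x₀ i| ≤ L) ∧
        ∀ t u i, |φ t i - φ u i| ≤ L * Real.sqrt (dist t u)} =
        (⋂ (t : I01) (u : I01) (i : Fin d), {f : I01 → Fin d → ℝ |
          |f t i - f u i| ≤ L * Real.sqrt (dist t u)}) ∩
        Set.univ.pi fun _ => Set.univ.pi fun i => Metric.closedBall (x₀ i) L := by
      ext f
      simp only [Set.mem_image, Set.mem_inter_iff, Set.mem_iInter, Set.mem_pi, Set.mem_univ,
        true_implies, Metric.mem_closedBall, Real.dist_eq, Set.mem_ofPred_eq]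
      constructor
      · rintro ⟨φ, ⟨h1, h2⟩, rfl⟩
        exact ⟨h2, h1⟩
      · rintro ⟨h2, h1⟩
        refine ⟨⟨f, continuous_pi fun i => ?_⟩, ⟨h1, h2⟩, rfl⟩
        rw [continuous_iff_continuousAt]
        intro t
        rw [ContinuousAt, tendsto_iff_dist_tendsto_zero]
        have hlim : Tendsto (fun u : I01 => L * Real.sqrt (dist u t)) (nhds t) (nhds 0) := by
          have : Continuous fun u : I01 => L * Real.sqrt (dist u t) := by fun_prop
          simpa using this.tendsto t
        exact squeeze_zero (fun _ => dist_nonneg) (fun u => h2 u t i) hlim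
    rw [himage]
    refine IsCompact.inter_left (isCompact_univ_pi fun _ => isCompact_univ_pi fun i =>
      isCompact_closedBall _ _) (isClosed_iInter fun t => isClosed_iInter fun u =>
        isClosed_iInter fun i => isClosed_le (by fun_prop) continuous_const)
  · refine Metric.equicontinuous_of_continuity_modulus (fun δ => |L| * Real.sqrt δ) ?_ _ ?_
    · have : Continuous fun δ : ℝ => |L| * Real.sqrt δ := by fun_prop
      simpa using this.tendsto 0
    · rintro t u ⟨φ, hφ⟩
      refine (dist_pi_le_iff (by positivity)).2 fun i => (hφ.2 t u i).trans ?_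
      gcongr
      exact le_abs_self L

/-- The function `(z, y, s) ↦ a(φ_s, y) + ∑ⱼ Bⱼ(φ_s, y) zⱼ`. -/
noncomputable def affineCtrl {d : ℕ}
    (a : BoundedContinuousFunction ((Fin d → ℝ) × Torus d) ℝ)
    (B : Fin d → BoundedContinuousFunction ((Fin d → ℝ) × Torus d) ℝ)
    (φ : C(I01, Fin d → ℝ)) (p : Spc d) : ℝ :=
  a (φ p.2.2, p.2.1) + ∑ j, B j (φ p.2.2, p.2.1) * p.1 j

section affineCtrl

variable {d : ℕ} (a : BoundedContinuousFunction ((Fin d → ℝ) × Torus d) ℝ)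
  (B : Fin d → BoundedContinuousFunction ((Fin d → ℝ) × Torus d) ℝ)

lemma continuous_affineCtrl : Continuous (Function.uncurry (affineCtrl a B)) := by
  have hφ : Continuous fun q : C(I01, Fin d → ℝ) × Spc d => (q.1 q.2.2.2, q.2.2.1) := by
    fun_prop
  exact (a.continuous.comp hφ).add (continuous_finsetSum _ fun j _ =>
    ((B j).continuous.comp hφ).mul (by fun_prop))

lemma abs_affineCtrl_le (φ : C(I01, Fin d → ℝ)) (p : Spc d) :
    |affineCtrl a B φ p| ≤ (‖a‖ + ∑ j, ‖B j‖) * (1 + ‖p.1‖) := by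
  have h1 : |a (φ p.2.2, p.2.1)| ≤ ‖a‖ := a.norm_coe_le_norm _
  have h2 : |∑ j, B j (φ p.2.2, p.2.1) * p.1 j| ≤ (∑ j, ‖B j‖) * ‖p.1‖ := by
    rw [Finset.sum_mul]
    refine (Finset.abs_sum_le_sum_abs _ _).trans (Finset.sum_le_sum fun j _ => ?_)
    rw [abs_mul]
    exact mul_le_mul ((B j).norm_coe_le_norm _) (norm_le_pi_norm p.1 j) (abs_nonneg _)
      (norm_nonneg _)
  have h3 : 0 ≤ ∑ j, ‖B j‖ := Finset.sum_nonneg fun j _ => norm_nonneg _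
  have h4 := mul_nonneg (norm_nonneg a) (norm_nonneg p.1)
  calc _ ≤ _ := abs_add_le _ _
    _ ≤ ‖a‖ + (∑ j, ‖B j‖) * ‖p.1‖ := add_le_add h1 h2
    _ ≤ _ := by nlinarith

lemma affineCtrl_growth_nonneg : 0 ≤ ‖a‖ + ∑ j, ‖B j‖ :=
  add_nonneg (norm_nonneg a) (Finset.sum_nonneg fun _ _ => norm_nonneg _)

lemma continuousOn_setIntegral_affineCtrl {C : ℝ} (hC : 0 ≤ C) (t : I01) :
    ContinuousOn (fun q : C(I01, Fin d → ℝ) × ProbabilityMeasure (Spc d) =>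
      ∫ p in {p : Spc d | (p.2.2 : ℝ) ≤ (t : ℝ)}, affineCtrl a B q.1 p ∂(q.2 : Measure (Spc d)))
      (Set.univ ×ˢ occMeasures d C) :=
  continuousOn_setIntegral_occMeasures hC (continuous_affineCtrl a B)
    (affineCtrl_growth_nonneg a B) (abs_affineCtrl_le a B) t

variable {C : ℝ} {P : ProbabilityMeasure (Spc d)}

lemma abs_setIntegral_affineCtrl_le (hC : 0 ≤ C) (hP : P ∈ occMeasures d C)
    (φ : C(I01, Fin d → ℝ)) (A : Set (Spc d)) :
    |∫ p in A, affineCtrl a B φ p ∂(P : Measure (Spc d))| ≤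
      (‖a‖ + ∑ j, ‖B j‖) * (2 + C) := by
  refine (occMeasures.abs_setIntegral_le hC hP (affineCtrl_growth_nonneg a B)
    (abs_affineCtrl_le a B φ) one_pos A).trans
    (mul_le_mul_of_nonneg_left ?_ (affineCtrl_growth_nonneg a B))
  have : (P : Measure (Spc d)).real A ≤ 1 := measureReal_le_one
  linarith

lemma abs_setIntegral_affineCtrl_sub_le (hC : 0 ≤ C) (hP : P ∈ occMeasures d C)
    (φ : C(I01, Fin d → ℝ)) (t u : I01) :
    |∫ p in {p : Spc d | (p.2.2 : ℝ) ≤ (t : ℝ)}, affineCtrl a B φ p ∂(P : Measure (Spc d)) -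
      ∫ p in {p : Spc d | (p.2.2 : ℝ) ≤ (u : ℝ)}, affineCtrl a B φ p ∂(P : Measure (Spc d))| ≤
      (‖a‖ + ∑ j, ‖B j‖) * (2 + C) * Real.sqrt (dist t u) := by
  wlog htu : u ≤ t generalizing t u
  · rw [abs_sub_comm, dist_comm]
    exact this u t (le_of_not_ge htu)
  rcases htu.eq_or_lt with rfl | hlt
  · simp
  have hlt' : (u : ℝ) < t := hlt
  have hsub : {p : Spc d | (p.2.2 : ℝ) ≤ (u : ℝ)} ⊆ {p | (p.2.2 : ℝ) ≤ (t : ℝ)} :=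
    fun p hp => le_trans hp htu
  have hint : Integrable (affineCtrl a B φ) (P : Measure (Spc d)) :=
    occMeasures.integrable_of_linear_growth hP
      ((continuous_affineCtrl a B).comp (Continuous.prodMk_right φ)) (abs_affineCtrl_le a B φ)
  have hdist : dist t u = (t : ℝ) - u := by
    rw [Subtype.dist_eq, Real.dist_eq, abs_of_pos (sub_pos.2 hlt')]
  rw [← setIntegral_sdiff (measurableSet_time_le _) hint.integrableOn hsub, hdist]
  set h := (t : ℝ) - u
  have hh : 0 < h := sub_pos.2 hlt'
  have hh1 : h ≤ 1 := by linarith [t.2.2, u.2.1]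
  set q := Real.sqrt h
  have hq : 0 < q := Real.sqrt_pos.2 hh
  have hq1 : q ≤ 1 := Real.sqrt_le_one.2 hh1
  have hqq : h = q ^ 2 := (Real.sq_sqrt hh.le).symm
  refine (occMeasures.abs_setIntegral_le hC hP (affineCtrl_growth_nonneg a B)
    (abs_affineCtrl_le a B φ) hq _).trans ?_
  rw [mul_assoc]
  refine mul_le_mul_of_nonneg_left ?_ (affineCtrl_growth_nonneg a B)
  rw [measureReal_sdiff hsub (measurableSet_time_le _), occMeasures.measureReal_time_le hP,
    occMeasures.measureReal_time_le hP]
  change (1 + 1 / (4 * q)) * h + q * C ≤ (2 + C) * q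
  have : (1 + 1 / (4 * q)) * h = q * (q + 1 / 4) := by
    rw [hqq]
    field_simp
  rw [this]
  nlinarith

end affineCtrl

lemma isOpenQuotientMap_torusProj (d : ℕ) : IsOpenQuotientMap (torusProj d) :=
  IsOpenQuotientMap.piMap fun _ => QuotientAddGroup.isOpenQuotientMap_mk

lemma torusProj_eq_torusProj_iff {d : ℕ} {w w' : Fin d → ℝ} :
    torusProj d w = torusProj d w' ↔ ∃ m : Fin d → ℤ, w' = w + fun i => (m i : ℝ) := by
  have h : ∀ i, ((w i : AddCircle (1 : ℝ)) = (w' i : AddCircle (1 : ℝ))) ↔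
      ∃ m : ℤ, w' i = w i + m := fun i => by
    rw [QuotientAddGroup.eq, AddSubgroup.mem_zmultiples_iff]
    refine exists_congr fun m => ?_
    rw [zsmul_one]
    constructor <;> intro h <;> linarith
  simp only [torusProj, funext_iff, h, Pi.add_apply]
  exact Classical.skolem

lemma exists_boundedContinuousFunction_of_lipschitz {d : ℕ} {f : (Fin d → ℝ) → Torus d → ℝ}
    {M : ℝ} (hM : ∀ x y, |f x y| ≤ M) {L : NNReal}
    (hL : LipschitzWith L fun p : (Fin d → ℝ) × (Fin d → ℝ) => f p.1 (torusProj d p.2)) :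
    ∃ g : BoundedContinuousFunction ((Fin d → ℝ) × Torus d) ℝ, ∀ x y, g (x, y) = f x y := by
  have hc : Continuous fun p : (Fin d → ℝ) × Torus d => f p.1 p.2 :=
    (IsOpenQuotientMap.id.prodMap (isOpenQuotientMap_torusProj d)).continuous_comp_iff.1
      hL.continuous
  exact ⟨BoundedContinuousFunction.ofNormedAddCommGroup _ hc M fun p => hM p.1 p.2,
    fun _ _ => rfl⟩

lemma exists_boundedContinuousFunction_of_periodic {d : ℕ} {u : (Fin d → ℝ) → ℝ}
    (hu : Continuous u) (hper : ∀ (w : Fin d → ℝ) (m : Fin d → ℤ), u (w + fun i => (m i : ℝ)) = u w) :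
    ∃ g : BoundedContinuousFunction ((Fin d → ℝ) × Torus d) ℝ,
      ∀ x w, g (x, torusProj d w) = u w := by
  have hq := isOpenQuotientMap_torusProj d
  let v : Torus d → ℝ := fun y => u (Function.surjInv hq.surjective y)
  have hv : ∀ w, v (torusProj d w) = u w := fun w => by
    obtain ⟨m, hm⟩ := torusProj_eq_torusProj_iff.1
      (Function.surjInv_eq hq.surjective (torusProj d w))
    exact ((congrArg u hm).trans (hper _ m)).symm
  have hvc : Continuous v := hq.continuous_comp_iff.1 (hu.congr fun w => (hv w).symm)
  exact ⟨(BoundedContinuousFunction.mkOfCompact ⟨v, hvc⟩).compContinuous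
    ⟨Prod.snd, continuous_snd⟩, fun x w => hv w⟩

lemma fderiv_add_of_periodic {d : ℕ} {u : (Fin d → ℝ) → ℝ} {v : Fin d → ℝ}
    (hper : ∀ w, u (w + v) = u w) (w : Fin d → ℝ) : fderiv ℝ u (w + v) = fderiv ℝ u w := by
  rw [← fderiv_comp_add_right, funext hper]

namespace IsC2Periodic

variable {d : ℕ} {F : (Fin d → ℝ) → ℝ}

lemma exists_fderiv (hF : IsC2Periodic F) (i : Fin d) :
    ∃ g : BoundedContinuousFunction ((Fin d → ℝ) × Torus d) ℝ,
      ∀ x w, g (x, torusProj d w) = fderiv ℝ F w (Pi.single i 1) := by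
  refine exists_boundedContinuousFunction_of_periodic ?_ fun w m => ?_
  · exact (hF.1.continuous_fderiv two_ne_zero).clm_apply continuous_const
  · rw [fderiv_add_of_periodic fun w => hF.2 w m]

lemma exists_fderiv_fderiv (hF : IsC2Periodic F) (i j : Fin d) :
    ∃ g : BoundedContinuousFunction ((Fin d → ℝ) × Torus d) ℝ,
      ∀ x w, g (x, torusProj d w) =
        fderiv ℝ (fun v => fderiv ℝ F v (Pi.single j 1)) w (Pi.single i 1) := by
  refine exists_boundedContinuousFunction_of_periodic ?_ fun w m => ?_
  · have h : ContDiff ℝ 1 fun v => fderiv ℝ F v (Pi.single j 1) :=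
      (hF.1.fderiv_right (m := 1) (by norm_num)).clm_apply contDiff_const
    exact (h.continuous_fderiv one_ne_zero).clm_apply continuous_const
  · rw [fderiv_add_of_periodic fun w => by rw [fderiv_add_of_periodic fun w => hF.2 w m]]

end IsC2Periodic

section coefficients

variable {d : ℕ} {γ : ℝ} {b c : (Fin d → ℝ) → Torus d → Fin d → ℝ}
  {σ : (Fin d → ℝ) → Torus d → Matrix (Fin d) (Fin d) ℝ}
  {b' c' : Fin d → BoundedContinuousFunction ((Fin d → ℝ) × Torus d) ℝ}
  {σ' : Fin d → Fin d → BoundedContinuousFunction ((Fin d → ℝ) × Torus d) ℝ}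

lemma affineCtrl_eq_lam2 (hb : ∀ i x y, b' i (x, y) = b x y i)
    (hc : ∀ i x y, c' i (x, y) = c x y i) (hσ : ∀ i j x y, σ' i j (x, y) = σ x y i j) (i : Fin d)
    (φ : C(I01, Fin d → ℝ)) (p : Spc d) :
    affineCtrl (γ • b' i + c' i) (σ' i) φ p = lam2 γ b c σ (φ p.2.2) p.2.1 p.1 i := by
  simp [affineCtrl, lam2, hb, hc, hσ, mulVec, dotProduct]

lemma exists_affineCtrl_eq_gen2 (hb : ∀ i x y, b' i (x, y) = b x y i)
    (hc : ∀ i x y, c' i (x, y) = c x y i) (hσ : ∀ i j x y, σ' i j (x, y) = σ x y i j)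
    {F : (Fin d → ℝ) → ℝ} (hF : IsC2Periodic F) :
    ∃ (a : BoundedContinuousFunction ((Fin d → ℝ) × Torus d) ℝ)
      (B : Fin d → BoundedContinuousFunction ((Fin d → ℝ) × Torus d) ℝ),
      ∀ (φ : C(I01, Fin d → ℝ)) (z : Ctrl d) (w : Fin d → ℝ) (s : I01),
        affineCtrl a B φ (z, torusProj d w, s) = gen2 γ b c σ (φ s) z F w := by
  choose D hD using hF.exists_fderiv
  choose D2 hD2 using hF.exists_fderiv_fderiv
  refine ⟨∑ i, (γ • b' i + c' i) * D i + (γ / 2) • ∑ i, ∑ j, (∑ k, σ' i k * σ' j k) * D2 i j,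
    fun j => ∑ i, σ' i j * D i, fun φ z w s => ?_⟩
  simp only [affineCtrl, gen2, lam2, BoundedContinuousFunction.coe_add,
    BoundedContinuousFunction.coe_sum, BoundedContinuousFunction.coe_mul,
    BoundedContinuousFunction.coe_smul, Pi.add_apply, Finset.sum_apply, Pi.mul_apply,
    hb, hc, hσ, hD, hD2, mulVec, dotProduct, mul_apply, transpose_apply, smul_eq_mul, add_mul,
    Finset.sum_add_distrib, Finset.sum_mul]
  rw [Finset.sum_comm (f := fun j i => σ (φ s) (torusProj d w) i j *
    fderiv ℝ F w (Pi.single i 1) * z j)]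
  have hcomm : ∀ i j, σ (φ s) (torusProj d w) i j * fderiv ℝ F w (Pi.single i 1) * z j =
      σ (φ s) (torusProj d w) i j * z j * fderiv ℝ F w (Pi.single i 1) := fun i j =>
    mul_right_comm _ _ _
  simp only [hcomm]
  ring

end coefficients

/-- The paths that form a viable pair with some occupation measure of second moment at most `C`
are a compact set. -/
lemma isCompact_setOf_exists_viable {d : ℕ} {γ : ℝ} {x₀ : Fin d → ℝ}
    {b c : (Fin d → ℝ) → Torus d → Fin d → ℝ}
    {σ : (Fin d → ℝ) → Torus d → Matrix (Fin d) (Fin d) ℝ}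
    {b' c' : Fin d → BoundedContinuousFunction ((Fin d → ℝ) × Torus d) ℝ}
    {σ' : Fin d → Fin d → BoundedContinuousFunction ((Fin d → ℝ) × Torus d) ℝ}
    (hb : ∀ i x y, b' i (x, y) = b x y i) (hc : ∀ i x y, c' i (x, y) = c x y i)
    (hσ : ∀ i j x y, σ' i j (x, y) = σ x y i j) {C : ℝ} (hC : 0 ≤ C) :
    IsCompact {φ : C(I01, Fin d → ℝ) | ∃ P ∈ occMeasures d C,
      IsViablePair γ x₀ b c σ φ (P : Measure (Spc d))} := by
  have hgen := fun F : {F : (Fin d → ℝ) → ℝ // IsC2Periodic F} =>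
    exists_affineCtrl_eq_gen2 (γ := γ) hb hc hσ F.2
  choose a B haB using hgen
  have hviable : ∀ φ, ∀ P ∈ occMeasures d C, IsViablePair γ x₀ b c σ φ (P : Measure (Spc d)) ↔
      (∀ (t : I01) (i : Fin d), φ t i = x₀ i + ∫ p in {p : Spc d | (p.2.2 : ℝ) ≤ (t : ℝ)},
        affineCtrl (γ • b' i + c' i) (σ' i) φ p ∂(P : Measure (Spc d))) ∧
      ∀ F (t : I01), ∫ p in {p : Spc d | (p.2.2 : ℝ) ≤ (t : ℝ)}, affineCtrl (a F) (B F) φ p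
        ∂(P : Measure (Spc d)) = 0 := by
    intro φ P hP
    simp only [affineCtrl_eq_lam2 hb hc hσ]
    constructor
    · rintro ⟨-, -, hdyn, hinv, -⟩
      exact ⟨fun t i => congrFun (hdyn t) i, fun F t => hinv F F.2 _ (haB F φ) t⟩
    · rintro ⟨hdyn, hinv⟩
      refine ⟨inferInstance, occMeasures.integrable_sum_sq hP, fun t => funext (hdyn t), ?_, hP.2⟩
      intro F hF g hg t
      have : g = affineCtrl (a ⟨F, hF⟩) (B ⟨F, hF⟩) φ := by
        funext ⟨z, y, s⟩
        obtain ⟨w, rfl⟩ := (isOpenQuotientMap_torusProj d).surjective y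
        rw [hg, haB]
      rw [this]
      exact hinv ⟨F, hF⟩ t
  obtain ⟨L, hL⟩ : ∃ L, ∀ i, (‖γ • b' i + c' i‖ + ∑ j, ‖σ' i j‖) * (2 + C) ≤ L := by
    obtain ⟨L, hL⟩ := (Set.finite_range fun i =>
      (‖γ • b' i + c' i‖ + ∑ j, ‖σ' i j‖) * (2 + C)).bddAbove
    exact ⟨L, fun i => hL (Set.mem_range_self i)⟩
  set S := {φ : C(I01, Fin d → ℝ) | (∀ t i, |φ t i - x₀ i| ≤ L) ∧
      ∀ t u i, |φ t i - φ u i| ≤ L * Real.sqrt (dist t u)} ×ˢ occMeasures d C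
  have hS : IsCompact S := (isCompact_setOf_holder_half x₀ L).prod (isCompact_occMeasures d hC)
  have : CompactSpace S := isCompact_iff_compactSpace.1 hS
  have hcont : ∀ a' B' (t : I01), Continuous fun q : S =>
      ∫ p in {p : Spc d | (p.2.2 : ℝ) ≤ (t : ℝ)}, affineCtrl a' B' q.1.1 p
        ∂(q.1.2 : Measure (Spc d)) := fun a' B' t =>
    continuousOn_iff_continuous_domRestrict.1
      ((continuousOn_setIntegral_affineCtrl a' B' hC t).mono
        (Set.prod_mono (Set.subset_univ _) subset_rfl))
  have hcompact : IsCompact ((fun q : S => q.1.1) ''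
      {q : S | (∀ (t : I01) (i : Fin d), q.1.1 t i = x₀ i +
        ∫ p in {p : Spc d | (p.2.2 : ℝ) ≤ (t : ℝ)},
          affineCtrl (γ • b' i + c' i) (σ' i) q.1.1 p ∂(q.1.2 : Measure (Spc d))) ∧
        ∀ F (t : I01), ∫ p in {p : Spc d | (p.2.2 : ℝ) ≤ (t : ℝ)}, affineCtrl (a F) (B F) q.1.1 p
          ∂(q.1.2 : Measure (Spc d)) = 0}) := by
    refine IsCompact.image (IsClosed.isCompact ?_) (by fun_prop)
    simp only [Set.ofPred_and, Set.ofPred_forall]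
    refine IsClosed.inter (isClosed_iInter fun t => isClosed_iInter fun i => isClosed_eq
      (by fun_prop) (continuous_const.add (hcont _ _ t)))
      (isClosed_iInter fun F => isClosed_iInter fun t => isClosed_eq (hcont _ _ t) continuous_const)
  convert hcompact using 1
  ext φ
  constructor
  · rintro ⟨P, hP, hφ⟩
    obtain ⟨hdyn, hinv⟩ := (hviable φ P hP).1 hφ
    refine ⟨⟨(φ, P), ⟨⟨fun t i => ?_, fun t u i => ?_⟩, hP⟩⟩, ⟨hdyn, hinv⟩, rfl⟩
    · rw [hdyn t i, add_sub_cancel_left]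
      exact (abs_setIntegral_affineCtrl_le _ _ hC hP φ _).trans (hL i)
    · rw [hdyn t i, hdyn u i, add_sub_add_left_eq_sub]
      exact (abs_setIntegral_affineCtrl_sub_le _ _ hC hP φ t u).trans
        (mul_le_mul_of_nonneg_right (hL i) (Real.sqrt_nonneg _))
  · rintro ⟨⟨⟨φ, P⟩, hφP⟩, hq, rfl⟩
    exact ⟨P, hφP.2, (hviable φ P hφP.2).2 hq⟩

lemma IsViablePair.exists_mem_occMeasures {d : ℕ} {γ : ℝ} {x₀ : Fin d → ℝ}
    {b c : (Fin d → ℝ) → Torus d → Fin d → ℝ}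
    {σ : (Fin d → ℝ) → Torus d → Matrix (Fin d) (Fin d) ℝ} {φ : C(I01, Fin d → ℝ)}
    {P : Measure (Spc d)} (h : IsViablePair γ x₀ b c σ φ P) {C : ℝ}
    (hC : ∫ p, ∑ i, (p.1 i) ^ 2 ∂P ≤ C) :
    ∃ Q ∈ occMeasures d C, (Q : Measure (Spc d)) = P := by
  refine ⟨⟨P, h.1⟩, ⟨?_, h.2.2.2.2⟩, rfl⟩
  change ∫⁻ p, ENNReal.ofReal (∑ i, (p.1 i) ^ 2) ∂P ≤ ENNReal.ofReal C
  rw [← ofReal_integral_eq_lintegral_ofReal h.2.1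
    (.of_forall fun p => Finset.sum_nonneg fun i _ => sq_nonneg _)]
  exact ENNReal.ofReal_le_ofReal hC

lemma S2_le_ofReal_iff {d : ℕ} {γ : ℝ} {x₀ : Fin d → ℝ}
    {b c : (Fin d → ℝ) → Torus d → Fin d → ℝ}
    {σ : (Fin d → ℝ) → Torus d → Matrix (Fin d) (Fin d) ℝ} {φ : C(I01, Fin d → ℝ)} {s : ℝ}
    (hs : 0 ≤ s) :
    S2 γ x₀ b c σ φ ≤ ENNReal.ofReal s ↔ ∀ n : ℕ, ∃ P ∈ occMeasures d (2 * (s + 1 / (n + 1))),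
      IsViablePair γ x₀ b c σ φ (P : Measure (Spc d)) := by
  constructor
  · intro h n
    have hn : 0 < 1 / ((n : ℝ) + 1) := by positivity
    have hlt : S2 γ x₀ b c σ φ < ENNReal.ofReal (s + 1 / (n + 1)) :=
      h.trans_lt ((ENNReal.ofReal_lt_ofReal_iff (by linarith)).2 (by linarith))
    obtain ⟨P, hP⟩ := iInf_lt_iff.1 hlt
    obtain ⟨hv, hP⟩ := iInf_lt_iff.1 hP
    have hcost := (ENNReal.ofReal_lt_ofReal_iff (by linarith)).1 hP
    obtain ⟨Q, hQ, rfl⟩ := hv.exists_mem_occMeasures (C := 2 * (s + 1 / (n + 1))) (by linarith)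
    exact ⟨Q, hQ, hv⟩
  · intro h
    have hlim : Tendsto (fun n : ℕ => ENNReal.ofReal (s + 1 / ((n : ℝ) + 1))) atTop
        (nhds (ENNReal.ofReal s)) := by
      refine ENNReal.tendsto_ofReal ?_
      simpa using tendsto_one_div_add_atTop_nhds_zero_nat.const_add s
    refine ge_of_tendsto' hlim fun n => ?_
    obtain ⟨P, hP, hv⟩ := h n
    refine (iInf₂_le (P : Measure (Spc d)) hv).trans (ENNReal.ofReal_le_ofReal ?_)
    have := occMeasures.integral_sum_sq_le (by positivity) hP
    linarith

/-- **Compactness of the level sets of the Regime 2 rate functional.**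
For every `s < ∞`, the level set `Φ_s = {φ ∈ C([0,1];ℝ^d) : S²(φ) ≤ s}` is a
compact subset of `C([0,1];ℝ^d)`. -/
theorem S2_levelSet_compact {d : ℕ} (hd : 1 ≤ d) (γ : ℝ) (hγ : 0 < γ)
    (x₀ : Fin d → ℝ)
    (b c : (Fin d → ℝ) → Torus d → Fin d → ℝ)
    (σ : (Fin d → ℝ) → Torus d → Matrix (Fin d) (Fin d) ℝ)
    -- boundedness of the coefficients
    (hbB : ∃ M, ∀ x y i, |b x y i| ≤ M) (hcB : ∃ M, ∀ x y i, |c x y i| ≤ M)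
    (hσB : ∃ M, ∀ x y i j, |σ x y i j| ≤ M)
    -- Lipschitz continuity of the coefficients (via periodic representatives)
    (hbL : ∃ L : NNReal, ∀ i, LipschitzWith L
      (fun p : (Fin d → ℝ) × (Fin d → ℝ) => b p.1 (torusProj d p.2) i))
    (hcL : ∃ L : NNReal, ∀ i, LipschitzWith L
      (fun p : (Fin d → ℝ) × (Fin d → ℝ) => c p.1 (torusProj d p.2) i))
    (hσL : ∃ L : NNReal, ∀ i j, LipschitzWith L
      (fun p : (Fin d → ℝ) × (Fin d → ℝ) => σ p.1 (torusProj d p.2) i j))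
    -- uniform nondegeneracy of `σσᵀ`
    (hnd : ∃ θ > (0 : ℝ), ∀ x y (ξ : Fin d → ℝ),
      θ * ∑ i, (ξ i) ^ 2 ≤ ξ ⬝ᵥ (σ x y * (σ x y)ᵀ).mulVec ξ)
    (s : ℝ) :
    IsCompact {φ : C(I01, Fin d → ℝ) | S2 γ x₀ b c σ φ ≤ ENNReal.ofReal s} := by
  obtain ⟨Mb, hMb⟩ := hbB
  obtain ⟨Mc, hMc⟩ := hcB
  obtain ⟨Mσ, hMσ⟩ := hσB
  obtain ⟨Lb, hLb⟩ := hbL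
  obtain ⟨Lc, hLc⟩ := hcL
  obtain ⟨Lσ, hLσ⟩ := hσL
  choose b' hb using fun i =>
    exists_boundedContinuousFunction_of_lipschitz (fun x y => hMb x y i) (hLb i)
  choose c' hc using fun i =>
    exists_boundedContinuousFunction_of_lipschitz (fun x y => hMc x y i) (hLc i)
  choose σ' hσ using fun i j =>
    exists_boundedContinuousFunction_of_lipschitz (fun x y => hMσ x y i j) (hLσ i j)
  have hs : ENNReal.ofReal s = ENNReal.ofReal (max s 0) := by
    rcases le_total s 0 with h | h
    · rw [max_eq_right h, ENNReal.ofReal_of_nonpos h, ENNReal.ofReal_zero]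
    · rw [max_eq_left h]
  simp only [hs, S2_le_ofReal_iff (le_max_right s 0), Set.ofPred_forall]
  have hcompact : ∀ n : ℕ, IsCompact {φ : C(I01, Fin d → ℝ) |
      ∃ P ∈ occMeasures d (2 * (max s 0 + 1 / (n + 1))),
        IsViablePair γ x₀ b c σ φ (P : Measure (Spc d))} := fun n =>
    isCompact_setOf_exists_viable hb hc hσ
      (mul_nonneg zero_le_two (add_nonneg (le_max_right s 0) (by positivity)))
  exact (hcompact 0).of_isClosed_subset (isClosed_iInter fun n => (hcompact n).isClosed)
    (Set.iInter_subset _ 0)
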